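/- There exists a universal constant c > 0 such that for every n ≥ 2, every monotone Boolean function f : {-1,1}^n → {-1,1}, and every Boolean function g : {-1,1}^n → {-1,1} with ĝ(∅) = 0 and ĝ({i}) = 0 for all i ∈ {1,…,n}, one has Pr_x[f(x) ≠ g(x)] ≥ c·√((log n)/n), where x is uniform on {-1,1}^n. -/

import Mathlib

open Finset

noncomputable section

/-- The value `±1` of a bit, with `true ↦ 1` and `false ↦ -1`. -/
def sgn (b : Bool) : ℝ := if b then 1 else -1

/-- Expectation of `f` over a uniformly random point of the hypercube `{-1,1}^ι`. -/
def expect {ι : Type*} [Fintype ι] [DecidableEq ι] (f : (ι → Bool) → ℝ) : ℝ :=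
  (∑ x : ι → Bool, f x) / 2 ^ (Fintype.card ι)

/-- Fourier coefficient `ĝ(S) = E[g(x) ∏_{i ∈ S} x_i]`. -/
def fcoef {ι : Type*} [Fintype ι] [DecidableEq ι] (g : (ι → Bool) → ℝ) (S : Finset ι) : ℝ :=
  expect (fun x => g x * ∏ i ∈ S, sgn (x i))

/-- `g` is `d`-resilient if all its Fourier coefficients of degree at most `d` vanish. -/
def Resilient {ι : Type*} [Fintype ι] [DecidableEq ι] (d : ℕ) (g : (ι → Bool) → ℝ) : Prop :=
  ∀ S : Finset ι, S.card ≤ d → fcoef g S = 0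

/-- `f` is Boolean-valued (takes values in `{-1,1}`). -/
def IsBooleanValued {ι : Type*} (f : (ι → Bool) → ℝ) : Prop := ∀ x, f x = 1 ∨ f x = -1

/-- `g` is bounded (takes values in `[-1,1]`). -/
def IsBounded {ι : Type*} (g : (ι → Bool) → ℝ) : Prop := ∀ x, |g x| ≤ 1

/-- `f` is `α`-approximately `d`-resilient: `f` is `α`-close in `ℓ₁` to a bounded
`d`-resilient function. -/
def ApproxResilient {ι : Type*} [Fintype ι] [DecidableEq ι] (α : ℝ) (d : ℕ)
    (f : (ι → Bool) → ℝ) : Prop :=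
  ∃ g : (ι → Bool) → ℝ, Resilient d g ∧ IsBounded g ∧ expect (fun x => |f x - g x|) ≤ α

section

/-! ### Bit flips, characters and discrete derivatives -/

variable {ι : Type*} [DecidableEq ι]

/-- The character `χ_S(x) = ∏_{i ∈ S} x_i`. -/
def chi (S : Finset ι) (x : ι → Bool) : ℝ := ∏ i ∈ S, sgn (x i)

/-- Negation of the `i`-th bit. -/
def flipBit (i : ι) (x : ι → Bool) : ι → Bool := Function.update x i (!x i)

/-- The discrete derivative `(f(x) - f(x ⊕ eᵢ)) / 2`. -/
def flipDeriv (f : (ι → Bool) → ℝ) (i : ι) (x : ι → Bool) : ℝ := (f x - f (flipBit i x)) / 2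

theorem flip_involutive (i : ι) : Function.Involutive (flipBit i) := by
  intro x
  simp [flipBit]

theorem sgn_not (b : Bool) : sgn (!b) = -sgn b := by
  cases b <;> simp [sgn]

theorem sgn_mul_self (b : Bool) : sgn b * sgn b = 1 := by
  cases b <;> simp [sgn]

theorem abs_sgn (b : Bool) : |sgn b| = 1 := by
  cases b <;> simp [sgn]

theorem sgn_flip_self (i : ι) (x : ι → Bool) : sgn (flipBit i x i) = -sgn (x i) := by
  simp [flipBit, sgn_not]

theorem chi_flip_of_notMem {S : Finset ι} {i : ι} (h : i ∉ S) (x : ι → Bool) :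
    chi S (flipBit i x) = chi S x := by
  unfold chi flipBit
  refine prod_congr rfl fun j hj => ?_
  rw [Function.update_of_ne]
  rintro rfl
  exact h hj

theorem chi_insert {S : Finset ι} {i : ι} (h : i ∉ S) (x : ι → Bool) :
    chi (insert i S) x = sgn (x i) * chi S x :=
  prod_insert h

theorem chi_flip_of_mem {S : Finset ι} {i : ι} (h : i ∈ S) (x : ι → Bool) :
    chi S (flipBit i x) = -chi S x := by
  rw [← insert_erase h, chi_insert (notMem_erase i S), chi_insert (notMem_erase i S),
    chi_flip_of_notMem (notMem_erase i S), sgn_flip_self, neg_mul]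

theorem flipDeriv_pow_four {f : (ι → Bool) → ℝ} (hf : IsBooleanValued f) (i : ι) (x : ι → Bool) :
    flipDeriv f i x ^ 4 = flipDeriv f i x ^ 2 := by
  unfold flipDeriv
  rcases hf x with h | h <;> rcases hf (flipBit i x) with h' | h' <;> rw [h, h'] <;> norm_num

theorem flipDeriv_mul_sgn {f : (ι → Bool) → ℝ} (hf : IsBooleanValued f) (hm : Monotone f)
    (i : ι) (x : ι → Bool) : flipDeriv f i x * sgn (x i) = flipDeriv f i x ^ 2 := by
  unfold flipDeriv
  cases hx : x i
  · have : f x ≤ f (flipBit i x) := hm <| by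
      unfold flipBit
      rw [le_update_iff]
      simp [hx]
    rcases hf x with h | h <;> rcases hf (flipBit i x) with h' | h' <;> rw [h, h'] at this ⊢ <;>
      first
        | norm_num [sgn]; done
        | norm_num at this
  · have : f (flipBit i x) ≤ f x := hm <| by
      unfold flipBit
      rw [update_le_iff]
      simp [hx]
    rcases hf x with h | h <;> rcases hf (flipBit i x) with h' | h' <;> rw [h, h'] at this ⊢ <;>
      first
        | norm_num [sgn]; done
        | norm_num at this

variable [Fintype ι]

/-! ### Expectations -/

theorem cube_expect_add (f g : (ι → Bool) → ℝ) :
    expect (fun x => f x + g x) = expect f + expect g := by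
  simp only [_root_.expect, sum_add_distrib, add_div]

theorem cube_expect_sub (f g : (ι → Bool) → ℝ) :
    expect (fun x => f x - g x) = expect f - expect g := by
  simp only [_root_.expect, sum_sub_distrib, sub_div]

theorem cube_expect_const_mul (c : ℝ) (f : (ι → Bool) → ℝ) :
    expect (fun x => c * f x) = c * expect f := by
  simp only [_root_.expect, ← mul_sum, mul_div_assoc]

theorem cube_expect_sum {κ : Type*} (s : Finset κ) (f : κ → (ι → Bool) → ℝ) :
    expect (fun x => ∑ k ∈ s, f k x) = ∑ k ∈ s, expect (f k) := by
  simp only [_root_.expect, sum_div]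
  exact sum_comm

theorem cube_expect_const (c : ℝ) : expect (fun _ : ι → Bool => c) = c := by
  simp [_root_.expect]

theorem cube_expect_mono {f g : (ι → Bool) → ℝ} (h : ∀ x, f x ≤ g x) : expect f ≤ expect g := by
  unfold _root_.expect
  gcongr
  exact h _

theorem cube_expect_nonneg {f : (ι → Bool) → ℝ} (h : ∀ x, 0 ≤ f x) : 0 ≤ expect f :=
  div_nonneg (sum_nonneg fun x _ => h x) (by positivity)

theorem expect_mul_sq_le (f g : (ι → Bool) → ℝ) :
    expect (fun x => f x * g x) ^ 2 ≤ expect (fun x => f x ^ 2) * expect (fun x => g x ^ 2) := by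
  unfold _root_.expect
  rw [div_pow, div_mul_div_comm, ← sq]
  gcongr
  exact sum_mul_sq_le_sq_mul_sq _ _ _

/-! ### Fourier expansion -/

theorem cube_expect_flip (i : ι) (f : (ι → Bool) → ℝ) :
    expect (fun x => f (flipBit i x)) = expect f := by
  unfold _root_.expect
  congr 1
  exact Equiv.sum_comp (flip_involutive i).toPerm f

theorem fcoef_eq (g : (ι → Bool) → ℝ) (S : Finset ι) :
    fcoef g S = expect (fun x => g x * chi S x) := rfl

theorem sum_chi_mul_chi {κ : Type*} [Fintype κ] (x y : κ → Bool) :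
    ∑ S : Finset κ, chi S x * chi S y = if x = y then 2 ^ Fintype.card κ else 0 := by
  have h : ∑ S : Finset κ, chi S x * chi S y = ∏ i, (1 + sgn (x i) * sgn (y i)) := by
    rw [prod_one_add]
    simp only [chi, prod_mul_distrib, powerset_univ]
  rw [h]
  split_ifs with hxy
  · subst hxy
    simp only [sgn_mul_self]
    norm_num [card_univ]
  · obtain ⟨i, hi⟩ := Function.ne_iff.mp hxy
    refine prod_eq_zero (mem_univ i) ?_
    revert hi
    cases x i <;> cases y i <;> simp [sgn]

/-- Fourier inversion on the hypercube. -/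
theorem sum_fcoef_mul_chi (f : (ι → Bool) → ℝ) (x : ι → Bool) :
    ∑ S, fcoef f S * chi S x = f x := by
  have h : ∑ S, fcoef f S * chi S x
      = (∑ y, f y * ∑ S : Finset ι, chi S y * chi S x) / 2 ^ Fintype.card ι := by
    simp only [fcoef_eq, _root_.expect, div_mul_eq_mul_div, ← sum_div, sum_mul, mul_sum]
    rw [sum_comm]
    simp only [mul_assoc]
  rw [h]
  simp [sum_chi_mul_chi]

/-- Parseval's identity. -/
theorem sum_fcoef_sq (f : (ι → Bool) → ℝ) :
    ∑ S, fcoef f S ^ 2 = expect (fun x => f x ^ 2) := by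
  have h : ∀ x, f x ^ 2 = ∑ S, fcoef f S * (f x * chi S x) := by
    intro x
    nth_rewrite 1 [sq]
    nth_rewrite 2 [← sum_fcoef_mul_chi f x]
    rw [mul_sum]
    exact sum_congr rfl fun S _ => by ring
  simp only [h, cube_expect_sum, cube_expect_const_mul, ← fcoef_eq, sq]

/-! ### Hypercontractivity -/

/-- Bonami's `(2,4)`-hypercontractive inequality. -/
theorem expect_pow_four_le (s : Finset ι) (c : Finset ι → ℝ) :
    expect (fun x => (∑ S ∈ s.powerset, c S * chi S x) ^ 4)
      ≤ (∑ S ∈ s.powerset, 3 ^ #S * c S ^ 2) ^ 2 := by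
  induction s using Finset.induction_on generalizing c with
  | empty =>
    simp [chi, cube_expect_const]
    exact le_of_eq (by ring)
  | insert a s ha ih =>
    have hmem : ∀ S ∈ s.powerset, a ∉ S := fun S hS h => ha (mem_powerset.mp hS h)
    set A : (ι → Bool) → ℝ := fun x => ∑ S ∈ s.powerset, c S * chi S x with hA
    set B : (ι → Bool) → ℝ := fun x => ∑ S ∈ s.powerset, c (insert a S) * chi S x with hB
    set α := ∑ S ∈ s.powerset, 3 ^ #S * c S ^ 2 with hα
    set β := ∑ S ∈ s.powerset, 3 ^ #S * c (insert a S) ^ 2 with hβ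
    have hα0 : 0 ≤ α := sum_nonneg fun S _ => by positivity
    have hβ0 : 0 ≤ β := sum_nonneg fun S _ => by positivity
    have hsplit : ∀ x, ∑ S ∈ (insert a s).powerset, c S * chi S x = A x + sgn (x a) * B x := by
      intro x
      rw [sum_powerset_insert ha, hA, hB, mul_sum]
      congr 1
      refine sum_congr rfl fun S hS => ?_
      rw [chi_insert (hmem S hS)]
      ring
    have hright : ∑ S ∈ (insert a s).powerset, 3 ^ #S * c S ^ 2 = α + 3 * β := by
      rw [sum_powerset_insert ha, hα, hβ, mul_sum]
      congr 1
      refine sum_congr rfl fun S hS => ?_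
      rw [card_insert_of_notMem (hmem S hS)]
      ring
    have hAflip : ∀ x, A (flipBit a x) = A x := fun x =>
      sum_congr rfl fun S hS => by rw [chi_flip_of_notMem (hmem S hS)]
    have hBflip : ∀ x, B (flipBit a x) = B x := fun x =>
      sum_congr rfl fun S hS => by rw [chi_flip_of_notMem (hmem S hS)]
    have hdouble : 2 * expect (fun x => (A x + sgn (x a) * B x) ^ 4)
        = 2 * (expect (fun x => A x ^ 4) + 6 * expect (fun x => A x ^ 2 * B x ^ 2)
          + expect (fun x => B x ^ 4)) := by
      rw [two_mul]
      nth_rewrite 2 [← cube_expect_flip a]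
      simp only [hAflip, hBflip, sgn_flip_self]
      rw [← cube_expect_add, ← cube_expect_const_mul, ← cube_expect_add,
        ← cube_expect_add, ← cube_expect_const_mul]
      congr 1
      funext x
      have h2 : sgn (x a) ^ 2 = 1 := by rw [sq, sgn_mul_self]
      have h4 : sgn (x a) ^ 4 = 1 := by rw [show 4 = 2 * 2 from rfl, pow_mul, h2, one_pow]
      linear_combination 12 * A x ^ 2 * B x ^ 2 * h2 + 2 * B x ^ 4 * h4
    have hAB : expect (fun x => A x ^ 2 * B x ^ 2) ≤ α * β := by
      refine abs_le_of_sq_le_sq' ?_ (by positivity) |>.2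
      calc _ ≤ _ := expect_mul_sq_le _ _
        _ = expect (fun x => A x ^ 4) * expect (fun x => B x ^ 4) := by
          simp only [← pow_mul]
        _ ≤ α ^ 2 * β ^ 2 := by
          gcongr
          · exact cube_expect_nonneg fun x => by positivity
          · exact ih c
          · exact ih fun S => c (insert a S)
        _ = _ := by ring
    have h1 := ih c
    have h2 := ih fun S => c (insert a S)
    simp only [hsplit, hright]
    change expect (fun x => A x ^ 4) ≤ α ^ 2 at h1
    change expect (fun x => B x ^ 4) ≤ β ^ 2 at h2
    nlinarith [sq_nonneg β]

/-- The dual form of hypercontractivity, for functions with values in `{-1, 0, 1}`. -/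
theorem sq_sum_fcoef_le {h : (ι → Bool) → ℝ} (hh : ∀ x, h x ^ 4 = h x ^ 2) :
    (∑ S, (1 / 3) ^ #S * fcoef h S ^ 2) ^ 2 ≤ expect (fun x => h x ^ 2) ^ 3 := by
  set Q := ∑ S, (1 / 3 : ℝ) ^ #S * fcoef h S ^ 2 with hQ
  set p := expect (fun x => h x ^ 2)
  have hQ0 : 0 ≤ Q := sum_nonneg fun S _ => by positivity
  have hp0 : 0 ≤ p := cube_expect_nonneg fun x => by positivity
  set P : (ι → Bool) → ℝ := fun x => ∑ S, ((1 / 3 : ℝ) ^ #S * fcoef h S) * chi S x with hP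
  have hhP : expect (fun x => h x * P x) = Q := by
    have : ∀ x, h x * P x = ∑ S, ((1 / 3 : ℝ) ^ #S * fcoef h S) * (h x * chi S x) := fun x => by
      rw [hP, mul_sum]
      exact sum_congr rfl fun S _ => by ring
    simp only [this, cube_expect_sum, cube_expect_const_mul, ← fcoef_eq, hQ]
    exact sum_congr rfl fun S _ => by ring
  have hP4 : expect (fun x => P x ^ 4) ≤ Q ^ 2 := by
    have := expect_pow_four_le univ fun S : Finset ι => (1 / 3 : ℝ) ^ #S * fcoef h S
    rw [powerset_univ] at this
    refine this.trans_eq ?_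
    congr 1
    refine sum_congr rfl fun S _ => ?_
    have : (3 : ℝ) ^ #S * (1 / 3) ^ #S = 1 := by rw [← mul_pow]; norm_num
    linear_combination (1 / 3 : ℝ) ^ #S * fcoef h S ^ 2 * this
  have h1 : Q ^ 2 ≤ p * expect (fun x => h x ^ 2 * P x ^ 2) := by
    have := expect_mul_sq_le h (fun x => P x * h x ^ 2)
    have e2 : ∀ x, h x * (P x * h x ^ 2) = h x * P x := fun x => by
      have : h x ^ 3 = h x := by
        rcases eq_or_ne (h x) 0 with h0 | h0
        · simp [h0]
        · exact mul_left_cancel₀ h0 (by linear_combination hh x)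
      linear_combination P x * this
    have e3 : ∀ x, (P x * h x ^ 2) ^ 2 = h x ^ 2 * P x ^ 2 := fun x => by
      linear_combination P x ^ 2 * hh x
    simpa only [e2, e3, hhP] using this
  have h2 : expect (fun x => h x ^ 2 * P x ^ 2) ^ 2 ≤ p * Q ^ 2 := by
    have := expect_mul_sq_le (fun x => h x ^ 2) (fun x => P x ^ 2)
    have e1 : ∀ x, (h x ^ 2) ^ 2 = h x ^ 2 := fun x => by
      linear_combination hh x
    have e2 : ∀ x, (P x ^ 2) ^ 2 = P x ^ 4 := fun x => by ring
    simp only [e1, e2] at this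
    exact this.trans (mul_le_mul_of_nonneg_left hP4 hp0)
  have h3 : Q ^ 2 * Q ^ 2 ≤ p ^ 3 * Q ^ 2 := by
    calc Q ^ 2 * Q ^ 2 = (Q ^ 2) ^ 2 := by ring
      _ ≤ (p * expect (fun x => h x ^ 2 * P x ^ 2)) ^ 2 := by gcongr
      _ = p ^ 2 * expect (fun x => h x ^ 2 * P x ^ 2) ^ 2 := by ring
      _ ≤ p ^ 2 * (p * Q ^ 2) := by gcongr
      _ = _ := by ring
  rcases hQ0.eq_or_lt with h0 | h0
  · rw [← h0, zero_pow two_ne_zero]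
    positivity
  · exact le_of_mul_le_mul_right h3 (by positivity)

/-! ### Influences of monotone functions -/

theorem fcoef_flipDeriv (f : (ι → Bool) → ℝ) (i : ι) (S : Finset ι) :
    fcoef (flipDeriv f i) S = if i ∈ S then fcoef f S else 0 := by
  have h : fcoef (flipDeriv f i) S
      = (1 / 2) * (fcoef f S - expect (fun x => f (flipBit i x) * chi S x)) := by
    rw [fcoef_eq, fcoef_eq, ← cube_expect_sub, ← cube_expect_const_mul]
    congr 1
    funext x
    rw [flipDeriv]
    ring
  rw [h, ← cube_expect_flip i]
  simp only [flip_involutive i _]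
  split_ifs with hi
  · simp only [chi_flip_of_mem hi, mul_neg]
    have := cube_expect_const_mul (-1) (fun x => f x * chi S x)
    simp only [neg_mul, one_mul] at this
    rw [this, ← fcoef_eq]
    ring
  · simp only [chi_flip_of_notMem hi]
    rw [← fcoef_eq]
    ring

theorem expect_flipDeriv_sq {f : (ι → Bool) → ℝ} (hf : IsBooleanValued f) (hm : Monotone f)
    (i : ι) : expect (fun x => flipDeriv f i x ^ 2) = fcoef f {i} := by
  have h := fcoef_flipDeriv f i {i}
  rw [if_pos (mem_singleton_self i)] at h
  rw [← h, fcoef_eq]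
  simp only [chi, prod_singleton, flipDeriv_mul_sgn hf hm]

theorem sum_ite_mem_mul (w : Finset ι → ℝ) :
    ∑ i, ∑ S, (if i ∈ S then w S else 0) = ∑ S, #S * w S := by
  rw [sum_comm]
  refine sum_congr rfl fun S _ => ?_
  simp

/-- The total influence of a monotone function, as a sum over the Fourier spectrum. -/
theorem sum_card_mul_fcoef_sq {f : (ι → Bool) → ℝ} (hf : IsBooleanValued f) (hm : Monotone f) :
    ∑ S, #S * fcoef f S ^ 2 = ∑ i, fcoef f {i} := by
  rw [← sum_ite_mem_mul]
  refine sum_congr rfl fun i _ => ?_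
  rw [← expect_flipDeriv_sq hf hm, ← sum_fcoef_sq]
  simp [fcoef_flipDeriv]

theorem sum_card_mul_noise_fcoef_sq_le {f : (ι → Bool) → ℝ} (hf : IsBooleanValued f)
    (hm : Monotone f) {M : ℝ} (hM0 : 0 ≤ M) (hM : ∀ i, fcoef f {i} ≤ M ^ 2) :
    ∑ S, #S * ((1 / 3) ^ #S * fcoef f S ^ 2) ≤ M * ∑ i, fcoef f {i} := by
  rw [← sum_ite_mem_mul, mul_sum]
  refine sum_le_sum fun i _ => ?_
  have h := sq_sum_fcoef_le (flipDeriv_pow_four hf i)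
  rw [expect_flipDeriv_sq hf hm] at h
  have hp : 0 ≤ fcoef f {i} := by
    rw [← expect_flipDeriv_sq hf hm]
    exact cube_expect_nonneg fun x => by positivity
  have e : ∑ S, (1 / 3 : ℝ) ^ #S * fcoef (flipDeriv f i) S ^ 2
      = ∑ S, if i ∈ S then (1 / 3 : ℝ) ^ #S * fcoef f S ^ 2 else 0 := by
    simp [fcoef_flipDeriv]
  rw [e] at h
  refine (abs_le_of_sq_le_sq' (h.trans ?_) (by positivity)).2
  calc fcoef f {i} ^ 3 = fcoef f {i} * fcoef f {i} ^ 2 := by ring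
    _ ≤ M ^ 2 * fcoef f {i} ^ 2 := by gcongr; exact hM i
    _ = _ := by ring

/-- A Kahn–Kalai–Linial type inequality for monotone functions. -/
theorem one_sub_fcoef_empty_sq_le {f : (ι → Bool) → ℝ} (hf : IsBooleanValued f)
    (hm : Monotone f) {M : ℝ} (hM0 : 0 ≤ M) (hM : ∀ i, fcoef f {i} ≤ M ^ 2)
    {d : ℕ} (hd : 0 < d) :
    1 - fcoef f ∅ ^ 2 ≤ (1 / d + 3 ^ d * M) * ∑ i, fcoef f {i} := by
  have hpars : ∑ S, fcoef f S ^ 2 = 1 := by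
    rw [sum_fcoef_sq]
    have : ∀ x, f x ^ 2 = 1 := fun x => by rcases hf x with h | h <;> rw [h] <;> norm_num
    simp only [this, cube_expect_const]
  have hpt : ∀ S : Finset ι, fcoef f S ^ 2 - (if S = ∅ then fcoef f S ^ 2 else 0)
      ≤ (1 / d) * (#S * fcoef f S ^ 2) + 3 ^ d * (#S * ((1 / 3) ^ #S * fcoef f S ^ 2)) := by
    intro S
    split_ifs with hS
    · rw [sub_self]
      positivity
    have hS1 : (1 : ℝ) ≤ #S := by
      exact_mod_cast card_pos.mpr (nonempty_iff_ne_empty.mpr hS)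
    have hd' : (0 : ℝ) < d := by exact_mod_cast hd
    rw [sub_zero]
    rcases le_total d #S with h | h
    · have h1 : (1 : ℝ) ≤ 1 / d * #S := by
        rw [one_div_mul_eq_div, one_le_div hd']
        exact_mod_cast h
      have h2 : 0 ≤ (3 : ℝ) ^ d * (#S * ((1 / 3) ^ #S * fcoef f S ^ 2)) := by positivity
      nlinarith [mul_le_mul_of_nonneg_right h1 (sq_nonneg (fcoef f S))]
    · have h1 : (1 : ℝ) ≤ 3 ^ d * (1 / 3) ^ #S := by
        rw [one_div, inv_pow, ← div_eq_mul_inv, one_le_div (by positivity)]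
        exact pow_le_pow_right₀ (by norm_num) h
      have h2 : 0 ≤ 1 / (d : ℝ) * (#S * fcoef f S ^ 2) := by positivity
      have h3 : (1 : ℝ) ≤ 3 ^ d * (1 / 3) ^ #S * #S := one_le_mul_of_one_le_of_one_le h1 hS1
      nlinarith [mul_le_mul_of_nonneg_right h3 (sq_nonneg (fcoef f S))]
  have hsum := sum_le_sum fun S (_ : S ∈ (univ : Finset (Finset ι))) => hpt S
  rw [sum_sub_distrib, sum_add_distrib, ← mul_sum, ← mul_sum, hpars, sum_ite_eq' univ,
    if_pos (mem_univ _), sum_card_mul_fcoef_sq hf hm] at hsum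
  refine hsum.trans ?_
  rw [add_mul, mul_assoc (3 ^ d)]
  gcongr
  exact sum_card_mul_noise_fcoef_sq_le hf hm hM0 hM

/-! ### Linear forms on sets of small measure -/

theorem expect_exp_sum (t : ℝ) :
    expect (fun x : ι → Bool => Real.exp (t * ∑ i, sgn (x i))) = Real.cosh t ^ Fintype.card ι := by
  have h : ∑ x : ι → Bool, Real.exp (t * ∑ i, sgn (x i))
      = ∏ _i : ι, ∑ b : Bool, Real.exp (t * sgn b) := by
    rw [prod_univ_sum]
    simp only [Fintype.piFinset_univ, mul_sum, Real.exp_sum]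
  rw [_root_.expect, h, prod_const, card_univ, ← div_pow, Real.cosh_eq]
  simp [sgn]

theorem expect_indicator_mul_abs_sum_le {u : (ι → Bool) → ℝ} (hu : ∀ x, 0 ≤ u x ∧ u x ≤ 1)
    {t : ℝ} (ht : 0 < t) (T : ℝ) :
    expect (fun x => u x * |∑ i, sgn (x i)|)
      ≤ T * expect u + 2 / t * Real.exp (Fintype.card ι * t ^ 2 / 2 - t * T) := by
  have hcosh : Real.cosh t ^ Fintype.card ι ≤ Real.exp (Fintype.card ι * t ^ 2 / 2) := by
    calc Real.cosh t ^ Fintype.card ι ≤ Real.exp (t ^ 2 / 2) ^ Fintype.card ι := by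
          gcongr
          exact Real.cosh_le_exp_half_sq t
      _ = _ := by rw [← Real.exp_nat_mul]; congr 1; ring
  have hpt : ∀ x : ι → Bool, u x * |∑ i, sgn (x i)| ≤ T * u x
      + Real.exp (-(t * T)) / t * (Real.exp (t * ∑ i, sgn (x i))
        + Real.exp (-t * ∑ i, sgn (x i))) := by
    intro x
    set s := ∑ i, sgn (x i)
    have h1 : t * (|s| - T) ≤ Real.exp (t * (|s| - T)) := by
      linarith [Real.add_one_le_exp (t * (|s| - T))]
    have h2 : Real.exp (t * |s|) ≤ Real.exp (t * s) + Real.exp (-t * s) := by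
      rcases abs_choice s with h | h <;> rw [h]
      · linarith [Real.exp_pos (-t * s)]
      · rw [mul_neg, ← neg_mul]
        linarith [Real.exp_pos (t * s)]
    have h3 : |s| - T ≤ Real.exp (-(t * T)) / t * (Real.exp (t * s) + Real.exp (-t * s)) := by
      rw [div_mul_eq_mul_div, le_div_iff₀ ht]
      calc (|s| - T) * t ≤ Real.exp (t * (|s| - T)) := by linarith
        _ = Real.exp (-(t * T)) * Real.exp (t * |s|) := by rw [← Real.exp_add]; congr 1; ring
        _ ≤ _ := by gcongr
    have h4 : 0 ≤ Real.exp (-(t * T)) / t * (Real.exp (t * s) + Real.exp (-t * s)) := by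
      positivity
    nlinarith [mul_le_mul_of_nonneg_left h3 (hu x).1, mul_le_mul_of_nonneg_right (hu x).2 h4]
  refine (cube_expect_mono hpt).trans ?_
  rw [cube_expect_add, cube_expect_const_mul, cube_expect_const_mul, cube_expect_add,
    expect_exp_sum, expect_exp_sum, Real.cosh_neg]
  refine add_le_add_right ?_ _
  calc Real.exp (-(t * T)) / t * (Real.cosh t ^ Fintype.card ι + Real.cosh t ^ Fintype.card ι)
      = 2 / t * (Real.exp (-(t * T)) * Real.cosh t ^ Fintype.card ι) := by ring
    _ ≤ 2 / t * (Real.exp (-(t * T)) * Real.exp (Fintype.card ι * t ^ 2 / 2)) := by gcongr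
    _ = _ := by rw [← Real.exp_add]; congr 2; ring

/-! ### Comparison with a `1`-resilient function -/

theorem fcoef_le_of_fcoef_eq_zero {f g : (ι → Bool) → ℝ} (hf : IsBooleanValued f)
    (hg : IsBooleanValued g) {S : Finset ι} (h : fcoef g S = 0) :
    |fcoef f S| ≤ 2 * expect (fun x => if f x = g x then (0 : ℝ) else 1) := by
  have e : fcoef f S = expect (fun x => (f x - g x) * chi S x) := by
    simp only [sub_mul, cube_expect_sub, ← fcoef_eq, h, sub_zero]
  have hb : ∀ x, |(f x - g x) * chi S x| ≤ 2 * (if f x = g x then (0 : ℝ) else 1) := by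
    intro x
    have : |chi S x| = 1 := by simp [chi, abs_prod, abs_sgn]
    rw [abs_mul, this, mul_one]
    rcases hf x with h | h <;> rcases hg x with h' | h' <;> rw [h, h'] <;> norm_num
  rw [e, abs_le]
  constructor
  · have := cube_expect_mono fun x => (abs_le.mp (hb x)).1
    simp only [← neg_mul, cube_expect_const_mul] at this
    linarith
  · have := cube_expect_mono fun x => (abs_le.mp (hb x)).2
    rwa [cube_expect_const_mul] at this

theorem sum_fcoef_singleton_le {f g : (ι → Bool) → ℝ} (hf : IsBooleanValued f)
    (hg : IsBooleanValued g) (h : ∀ i, fcoef g {i} = 0) :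
    ∑ i, fcoef f {i} ≤
      2 * expect (fun x => (if f x = g x then (0 : ℝ) else 1) * |∑ i, sgn (x i)|) := by
  have e : ∑ i, fcoef f {i} = expect (fun x => (f x - g x) * ∑ i, sgn (x i)) := by
    simp only [mul_sum, cube_expect_sum, sub_mul, cube_expect_sub]
    refine sum_congr rfl fun i _ => ?_
    have := h i
    simp only [fcoef, prod_singleton] at this ⊢
    rw [this, sub_zero]
  rw [e, ← cube_expect_const_mul]
  refine cube_expect_mono fun x => ?_
  set s := ∑ i, sgn (x i)
  have h1 := le_abs_self s
  have h2 := neg_le_abs s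
  rcases hf x with h | h <;> rcases hg x with h' | h' <;> rw [h, h'] <;> norm_num <;> linarith

theorem one_le_of_small_dimension {ε I n : ℝ} (hn : 1 ≤ n) (hε0 : 0 ≤ ε) (hε1 : ε ≤ 1)
    (hI0 : 0 ≤ I) (hI : I ≤ 2 * ε * n) (h : 1 - 4 * ε ^ 2 ≤ (1 + 3 * √(2 * ε)) * I) :
    1 ≤ 16 * (ε * n) := by
  have hs : √(2 * ε) ≤ 5 / 3 := by
    rw [Real.sqrt_le_left (by norm_num)]
    linarith
  have h1 : (1 + 3 * √(2 * ε)) * I ≤ 6 * (2 * ε * n) := by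
    apply mul_le_mul _ hI hI0 (by norm_num)
    linarith
  nlinarith [mul_nonneg hε0 (sub_nonneg.mpr hε1), mul_nonneg hε0 (sub_nonneg.mpr hn)]

theorem large_dimension_contradiction {n L t ε I : ℝ} (hn : 4000 ≤ n) (hexp : Real.exp L = n)
    (hL : 1 ≤ L) (ht0 : 0 < t) (hnt : n * t ^ 2 = L) (ht1 : t ≤ 1) (hε0 : 0 ≤ ε)
    (hε : ε ≤ 1 / 100000 * t) (hI0 : 0 ≤ I)
    (hI : I ≤ 2 * (2 * (n * t) * ε + 2 / t * Real.exp (-(3 / 2 * L))))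
    (hkkl : ∀ M : ℝ, 0 ≤ M → 2 * ε ≤ M ^ 2 → ∀ d : ℕ, 0 < d →
      1 - 4 * ε ^ 2 ≤ (1 / d + 3 ^ d * M) * I) : False := by
  have hn0 : 0 < n := by linarith
  have ht_lower : Real.exp (-(1 / 2 * L)) ≤ t := by
    refine (abs_le_of_sq_le_sq' ?_ ht0.le).2
    rw [← Real.exp_nat_mul, show ((2 : ℕ) : ℝ) * -(1 / 2 * L) = -L by push_cast; ring,
      Real.exp_neg, hexp, inv_le_iff_one_le_mul₀ hn0]
    linarith
  have htail : 2 / t * Real.exp (-(3 / 2 * L)) ≤ 2 / 4000 := by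
    have h1 : Real.exp (-(3 / 2 * L)) = Real.exp (-(1 / 2 * L)) * n⁻¹ := by
      rw [← hexp, ← Real.exp_neg, ← Real.exp_add]
      congr 1
      ring
    have h2 : n⁻¹ ≤ 1 / 4000 := by
      rw [one_div]
      exact inv_anti₀ (by norm_num) hn
    calc 2 / t * Real.exp (-(3 / 2 * L)) ≤ 2 / t * (t * (1 / 4000)) := by rw [h1]; gcongr
      _ = 2 / 4000 := by field_simp
  have hIL : I ≤ L / 200 := by
    have : n * t * ε ≤ L / 100000 := by
      calc n * t * ε ≤ n * t * (1 / 100000 * t) := by gcongr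
        _ = L / 100000 := by linear_combination hnt / 100000
    linarith
  have ht_upper : t ≤ 3 * Real.exp (-(2 / 5 * L)) := by
    refine (abs_le_of_sq_le_sq' ?_ (by positivity)).2
    have h1 : L ≤ 5 * Real.exp (1 / 5 * L) := by linarith [Real.add_one_le_exp (1 / 5 * L)]
    have h2 : Real.exp (1 / 5 * L) = n * Real.exp (-(2 / 5 * L)) ^ 2 := by
      rw [← hexp, ← Real.exp_nat_mul, ← Real.exp_add]
      congr 1
      push_cast
      ring
    rw [h2] at h1
    refine le_of_mul_le_mul_left ?_ hn0
    rw [hnt]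
    nlinarith [mul_nonneg hn0.le (sq_nonneg (Real.exp (-(2 / 5 * L))))]
  set M := 2 * Real.exp (-(1 / 5 * L)) with hM
  have hM2 : 2 * ε ≤ M ^ 2 := by
    have : M ^ 2 = 4 * Real.exp (-(2 / 5 * L)) := by
      rw [hM, mul_pow, ← Real.exp_nat_mul]
      norm_num
      ring_nf
    rw [this]
    linarith [Real.exp_pos (-(2 / 5 * L))]
  have hd : 0 < ⌈L / 50⌉₊ := Nat.ceil_pos.mpr (by linarith)
  have h := hkkl M (by positivity) hM2 _ hd
  set d := ⌈L / 50⌉₊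
  have hd_lower : L / 50 ≤ d := Nat.le_ceil _
  have hd_upper : (d : ℝ) ≤ L / 50 + 1 := (Nat.ceil_lt_add_one (by positivity)).le
  have hfirst : 1 / d * I ≤ 1 / 4 := by
    rw [one_div_mul_eq_div, div_le_iff₀ (by exact_mod_cast hd)]
    linarith
  have hpow : (3 : ℝ) ^ d ≤ 9 * Real.exp (1 / 25 * L) := by
    have h3 : (3 : ℝ) ≤ Real.exp 2 := by linarith [Real.add_one_le_exp 2]
    have h9 : Real.exp 2 ≤ 9 := by
      rw [show (2 : ℝ) = 1 + 1 by norm_num, Real.exp_add]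
      nlinarith [Real.exp_one_lt_d9, Real.exp_pos 1]
    calc (3 : ℝ) ^ d ≤ Real.exp 2 ^ d := by gcongr
      _ = Real.exp (d * 2) := by rw [Real.exp_nat_mul]
      _ ≤ Real.exp (2 + 1 / 25 * L) := by
        apply Real.exp_le_exp.mpr
        linarith
      _ = Real.exp 2 * Real.exp (1 / 25 * L) := Real.exp_add _ _
      _ ≤ _ := by gcongr
  have hsecond : 3 ^ d * M * I ≤ 9 / 16 := by
    have hLe : L * Real.exp (-(4 / 25 * L)) ≤ 25 / 4 := by
      rw [Real.exp_neg, ← div_eq_mul_inv, div_le_iff₀ (Real.exp_pos _)]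
      linarith [Real.add_one_le_exp (4 / 25 * L)]
    calc 3 ^ d * M * I ≤ 9 * Real.exp (1 / 25 * L) * M * (L / 200) := by gcongr
      _ = 9 / 100 * (L * (Real.exp (1 / 25 * L) * Real.exp (-(1 / 5 * L)))) := by
        rw [hM]
        ring
      _ = 9 / 100 * (L * Real.exp (-(4 / 25 * L))) := by
        rw [← Real.exp_add]
        congr 3
        ring
      _ ≤ 9 / 16 := by linarith
  have hεsq : ε ^ 2 ≤ 1 / 100 := by nlinarith
  linarith [add_mul (1 / (d : ℝ)) (3 ^ d * M) I]

end

/-- **Monotone functions are far from `1`-resilient Boolean functions.** There is a universal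
`c > 0` such that for every `n ≥ 2`, every monotone Boolean `f : {-1,1}^n → {-1,1}` and every
Boolean `g : {-1,1}^n → {-1,1}` with `ĝ(∅) = 0` and `ĝ({i}) = 0` for all `i`, one has
`Pr_x[f(x) ≠ g(x)] ≥ c·√((log n)/n)`. -/
theorem stmt9 :
    ∃ c : ℝ, 0 < c ∧
      ∀ n : ℕ, 2 ≤ n →
      ∀ f g : (Fin n → Bool) → ℝ,
        IsBooleanValued f → Monotone f →
        IsBooleanValued g → fcoef g ∅ = 0 → (∀ i : Fin n, fcoef g {i} = 0) →
        c * Real.sqrt (Real.log n / n) ≤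
          expect (fun x => if f x = g x then (0 : ℝ) else 1) := by
  refine ⟨1 / 100000, by norm_num, fun n hn f g hf hm hg hg0 hg1 => ?_⟩
  set u : (Fin n → Bool) → ℝ := fun x => if f x = g x then (0 : ℝ) else 1 with hu
  set ε := expect u with hε
  set I := ∑ i, fcoef f {i} with hI
  have hu01 : ∀ x, 0 ≤ u x ∧ u x ≤ 1 := fun x => by
    simp only [hu]
    split_ifs <;> norm_num
  have hε0 : 0 ≤ ε := cube_expect_nonneg fun x => (hu01 x).1
  have hε1 : ε ≤ 1 := (cube_expect_mono fun x => (hu01 x).2).trans_eq (cube_expect_const 1)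
  have hI0 : 0 ≤ I := by
    rw [hI, ← sum_card_mul_fcoef_sq hf hm]
    exact sum_nonneg fun S _ => by positivity
  have hIu : I ≤ 2 * expect (fun x => u x * |∑ i, sgn (x i)|) := sum_fcoef_singleton_le hf hg hg1
  have hmean : fcoef f ∅ ^ 2 ≤ 4 * ε ^ 2 := by
    have := fcoef_le_of_fcoef_eq_zero hf hg hg0
    rw [← sq_abs]
    calc |fcoef f ∅| ^ 2 ≤ (2 * ε) ^ 2 := by gcongr
      _ = _ := by ring
  have hinf : ∀ i, fcoef f {i} ≤ 2 * ε := fun i =>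
    (le_abs_self _).trans (fcoef_le_of_fcoef_eq_zero hf hg (hg1 i))
  have hkkl : ∀ M : ℝ, 0 ≤ M → 2 * ε ≤ M ^ 2 → ∀ d : ℕ, 0 < d →
      1 - 4 * ε ^ 2 ≤ (1 / d + 3 ^ d * M) * I := fun M hM0 hM d hd =>
    (sub_le_sub_left hmean 1).trans
      (one_sub_fcoef_empty_sq_le hf hm hM0 (fun i => (hinf i).trans hM) hd)
  have hn2 : (2 : ℝ) ≤ n := by exact_mod_cast hn
  have hn0 : (0 : ℝ) < n := by linarith
  by_contra! hlt
  have hratio : √(Real.log n / n) ≤ 1 := by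
    rw [Real.sqrt_le_one, div_le_one hn0]
    exact Real.log_le_self hn0.le
  rcases le_total (n : ℝ) 4000 with hsmall | hlarge
  · have hIn : I ≤ 2 * ε * n := by
      refine hIu.trans ?_
      have : expect (fun x => u x * |∑ i, sgn (x i)|) ≤ n * ε := by
        rw [hε, ← cube_expect_const_mul]
        refine cube_expect_mono fun x => ?_
        rw [mul_comm]
        refine mul_le_mul_of_nonneg_right ?_ (hu01 x).1
        refine (abs_sum_le_sum_abs _ _).trans_eq ?_
        simp [abs_sgn]
      linarith
    have h := hkkl √(2 * ε) (by positivity) (Real.sq_sqrt (by positivity)).ge 1 one_pos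
    rw [Nat.cast_one, div_one, pow_one] at h
    have := one_le_of_small_dimension (by linarith) hε0 hε1 hI0 hIn h
    nlinarith
  · set L := Real.log n with hL
    have hexp : Real.exp L = n := Real.exp_log hn0
    have hL1 : 1 ≤ L := by
      rw [hL, Real.le_log_iff_exp_le hn0]
      linarith [Real.exp_one_lt_d9]
    set t := √(L / n) with ht
    have ht2 : t ^ 2 = L / n := Real.sq_sqrt (by positivity)
    have hnt : n * t ^ 2 = L := by rw [ht2]; field_simp
    have ht0 : 0 < t := Real.sqrt_pos.mpr (by positivity)
    have htail := expect_indicator_mul_abs_sum_le hu01 ht0 (2 * (n * t))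
    rw [Fintype.card_fin, ← hε, show (n : ℝ) * t ^ 2 / 2 - t * (2 * (n * t)) = -(3 / 2 * L) by
      linear_combination (-3 / 2) * hnt] at htail
    exact large_dimension_contradiction hlarge hexp hL1 ht0 hnt hratio hε0 hlt.le hI0
      (by linarith) hkkl
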